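/- Let n ≥ 2, d = n(n+1)/2 − 1, and let B_1, …, B_d be an orthonormal basis (with respect to the trace inner product) of the space of n×n real symmetric matrices with trace zero. For a real symmetric n×n matrix X, let A(X) be the d×d symmetric matrix with A(X)_{11} = tr(B_1 X), A(X)_{1j} = A(X)_{j1} = tr(B_j X) for 2 ≤ j ≤ d, A(X)_{jj} = −tr(B_1 X) for 2 ≤ j ≤ d, and all other entries zero. Then X belongs to S^{n,n−2} if and only if √((n−1)/n)·tr(X)·I_d + A(X) is positive semidefinite; in particular, S^{n,n−2} has a spectrahedral representation of size n(n+1)/2 − 1. -/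

import Mathlib

open Matrix Finset

/-- `Ek n k X` is the coefficient of `t ^ (n - k)` in `det (t • 1 + X)`, i.e. the elementary
symmetric polynomial of degree `k` evaluated at the eigenvalues of `X`. -/
noncomputable def Ek (n k : ℕ) (X : Matrix (Fin n) (Fin n) ℝ) : ℝ :=
  (Matrix.charpoly (-X)).coeff (n - k)


lemma aux_esymm (s : Multiset ℝ) : 2 * s.esymm 2 = s.sum ^ 2 - (s.map (fun x => x ^ 2)).sum := by
  induction s using Multiset.induction with
  | empty => simp [Multiset.esymm, Multiset.powersetCard_zero_right]
  | cons a s ih =>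
    have h1 : (a ::ₘ s).esymm 2 = s.esymm 2 + a * s.sum := by
      simp [Multiset.esymm, Multiset.powersetCard_cons, Multiset.powersetCard_one,
        Multiset.map_map]
      simpa using Multiset.sum_map_mul_left (s := s) (a := a) (f := fun x => x)
    rw [h1, Multiset.map_cons, Multiset.sum_cons, Multiset.sum_cons, mul_add, ih]
    ring

lemma aux_trace_sq {n : ℕ} (Y : Matrix (Fin n) (Fin n) ℝ) (hY : Y.IsHermitian) :
    (Y * Y).trace = ∑ i, hY.eigenvalues i ^ 2 := by
  have h := hY.spectral_theorem
  have h2 : Y * Y = Unitary.conjStarAlgAut ℝ _ hY.eigenvectorUnitary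
      (diagonal (fun i => hY.eigenvalues i ^ 2)) := by
    conv_lhs => rw [h]
    rw [← map_mul, diagonal_mul_diagonal]
    congr 2
    funext i
    simp [sq]
  rw [h2, Unitary.conjStarAlgAut_apply, Matrix.trace_mul_cycle]
  simp [trace_diagonal]

lemma aux_Ek {n : ℕ} (hn : 2 ≤ n) (X : Matrix (Fin n) (Fin n) ℝ) (hX : X.IsHermitian) :
    2 * Ek n 2 X = X.trace ^ 2 - (X * X).trace := by
  have hY : (-X).IsHermitian := hX.neg
  have e1 : X.trace ^ 2 = (-X).trace ^ 2 := by simp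
  have e2 : X * X = (-X) * (-X) := by simp
  rw [e1, e2, Ek]
  generalize -X = Y at hY
  have h3 := Multiset.prod_X_sub_C_coeff (Finset.univ.val.map hY.eigenvalues) (k := n - 2)
    (by simp)
  rw [Multiset.map_map] at h3
  have h4 : n - (n - 2) = 2 := by omega
  simp only [Multiset.card_map, Finset.card_val, Finset.card_univ, Fintype.card_fin, h4] at h3
  have h5 := aux_esymm (Finset.univ.val.map hY.eigenvalues)
  rw [hY.charpoly_eq, aux_trace_sq Y hY, hY.trace_eq_sum_eigenvalues]
  have h6 : (∏ i, (Polynomial.X - Polynomial.C ((hY.eigenvalues i : ℝ) : ℝ))).coeff (n - 2)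
      = (Finset.univ.val.map hY.eigenvalues).esymm 2 := by
    simpa [Finset.prod, Function.comp_def] using h3
  rw [Multiset.map_map] at h5
  refine Eq.trans ?_ (h5.trans ?_)
  · rw [← h6]; rfl
  · rfl

lemma aux_trace_shift {n : ℕ} (X : Matrix (Fin n) (Fin n) ℝ) (t : ℝ) :
    ((X - t • 1) * (X - t • 1)).trace = (X * X).trace - 2 * t * X.trace + n * t ^ 2 := by
  simp [sub_mul, mul_sub, trace_sub]
  ring

lemma aux_quad {n : ℕ} (hn : 2 ≤ n) (X : Matrix (Fin n) (Fin n) ℝ) (hX : X.IsHermitian) (t : ℝ) :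
    Ek n 2 (X - t • 1) = 0 ↔
      (n : ℝ) * (n - 1) * t ^ 2 - 2 * (n - 1) * X.trace * t + X.trace ^ 2 - (X * X).trace = 0 := by
  have h1 : (X - t • (1 : Matrix (Fin n) (Fin n) ℝ)).IsHermitian :=
    hX.sub (by simp [Matrix.IsHermitian])
  have h := aux_Ek hn _ h1
  rw [aux_trace_shift] at h
  have h2 : (X - t • (1 : Matrix (Fin n) (Fin n) ℝ)).trace = X.trace - n * t := by
    simp [trace_sub]; ring
  rw [h2] at h
  constructor <;> intro h3 <;> nlinarith

/-- roots nonneg iff cone condition; `R` is the squared norm of the traceless part -/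
lemma aux_roots (m T Q R : ℝ) (hm : 2 ≤ m) (hR : R = Q - T ^ 2 / m) (hR0 : 0 ≤ R) :
    (∀ t : ℝ, m * (m - 1) * t ^ 2 - 2 * (m - 1) * T * t + T ^ 2 - Q = 0 → 0 ≤ t) ↔
      0 ≤ Real.sqrt ((m - 1) / m) * T ∧ R ≤ (Real.sqrt ((m - 1) / m) * T) ^ 2 := by
  have hm0 : 0 < m := by linarith
  have hm1 : 0 < m - 1 := by linarith
  have hk : 0 < (m - 1) / m := by positivity
  have hs : 0 < Real.sqrt ((m - 1) / m) := Real.sqrt_pos.2 hk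
  rw [mul_pow, Real.sq_sqrt hk.le, mul_nonneg_iff_of_pos_left hs]
  have hQ : R ≤ (m - 1) / m * T ^ 2 ↔ Q ≤ T ^ 2 := by
    have : (m - 1) / m * T ^ 2 = T ^ 2 - T ^ 2 / m := by field_simp
    rw [this, hR]; constructor <;> intro h <;> linarith
  rw [hQ]
  constructor
  · intro h
    set u := Real.sqrt (R / (m * (m - 1))) with hu
    have hu2 : u ^ 2 = R / (m * (m - 1)) := Real.sq_sqrt (by positivity)
    have hu0 : 0 ≤ u := Real.sqrt_nonneg _
    have h2 := h (T / m - u) (by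
      have : m * (m - 1) * (T / m - u) ^ 2 - 2 * (m - 1) * T * (T / m - u) + T ^ 2 - Q
        = m * (m - 1) * u ^ 2 - (Q - T ^ 2 / m) := by field_simp; ring
      rw [this, hu2, hR]; field_simp; ring)
    have hT : u ≤ T / m := by linarith
    have hT0 : 0 ≤ T / m := by linarith
    refine ⟨by have := mul_nonneg hT0 hm0.le; rwa [div_mul_cancel₀ _ hm0.ne'] at this, ?_⟩
    have h3 : u ^ 2 ≤ (T / m) ^ 2 := pow_le_pow_left₀ hu0 hT 2
    rw [hu2, div_le_iff₀ (by positivity)] at h3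
    have : (T / m) ^ 2 * (m * (m - 1)) = T ^ 2 - T ^ 2 / m := by field_simp
    linarith
  · rintro ⟨hT, hQT⟩ t ht
    by_contra hlt
    push Not at hlt
    have a1 : 0 < m * (m - 1) * t ^ 2 := by
      have := pow_pos (neg_pos.2 hlt) 2
      have : 0 < t ^ 2 := by simpa using this
      positivity
    have a2 : 0 ≤ 2 * (m - 1) * T * (-t) := by
      have : 0 ≤ -t := by linarith
      positivity
    nlinarith

lemma aux_psd (d : ℕ) (hd : 2 ≤ d) (s : ℝ) (c : Fin d → ℝ) (M : Matrix (Fin d) (Fin d) ℝ)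
    (hM : M = s • (1 : Matrix (Fin d) (Fin d) ℝ) +
        Matrix.of (fun i j : Fin d =>
          if (i : ℕ) = 0 ∧ (j : ℕ) = 0 then c i
          else if (i : ℕ) = 0 then c j
          else if (j : ℕ) = 0 then c i
          else if i = j then -(c ⟨0, by omega⟩)
          else 0)) :
    (0 ≤ s ∧ ∑ i, c i ^ 2 ≤ s ^ 2) ↔ M.PosSemidef := by
  obtain ⟨e, rfl⟩ : ∃ e, d = e + 2 := ⟨d - 2, by omega⟩
  have hq : ∀ v : Fin (e + 2) → ℝ, star v ⬝ᵥ (M *ᵥ v) =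
      (s + c 0) * v 0 ^ 2 + 2 * v 0 * (∑ j : Fin (e + 1), c j.succ * v j.succ)
        + (s - c 0) * ∑ j : Fin (e + 1), v j.succ ^ 2 := by
    intro v
    have r0 : (M *ᵥ v) 0 = (s + c 0) * v 0 + ∑ j : Fin (e + 1), c j.succ * v j.succ := by
      rw [hM, Matrix.mulVec, dotProduct, Fin.sum_univ_succ]
      congr 1
      · simp
      · refine Finset.sum_congr rfl fun j _ => ?_
        simp [Matrix.one_apply, (Fin.succ_ne_zero j).symm]
    have rs : ∀ j : Fin (e + 1), (M *ᵥ v) j.succ = c j.succ * v 0 + (s - c 0) * v j.succ := by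
      intro j
      rw [hM, Matrix.mulVec, dotProduct, Fin.sum_univ_succ]
      congr 1
      · simp [Matrix.one_apply]
      · rw [Finset.sum_eq_single j]
        · simp; left; rfl
        · intro k _ hk
          simp [Matrix.one_apply, Ne.symm hk]
        · simp
    rw [dotProduct, Fin.sum_univ_succ, r0]
    simp only [rs, Pi.star_apply, star_trivial]
    simp only [mul_add, Finset.sum_add_distrib, Finset.mul_sum]
    have t1 : ∀ i : Fin (e + 1), v i.succ * (c i.succ * v 0) = v 0 * (c i.succ * v i.succ) :=
      fun i => by ring
    have t2 : ∀ i : Fin (e + 1), v i.succ * ((s - c 0) * v i.succ) = (s - c 0) * v i.succ ^ 2 :=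
      fun i => by ring
    have t3 : ∀ i : Fin (e + 1), 2 * v 0 * (c i.succ * v i.succ) = 2 * (v 0 * (c i.succ * v i.succ)) :=
      fun i => by ring
    simp only [t1, t2, t3, ← Finset.mul_sum]
    ring
  rw [Fin.sum_univ_succ]
  set C := ∑ j : Fin (e + 1), c j.succ ^ 2 with hC
  have hC0 : 0 ≤ C := Finset.sum_nonneg fun _ _ => sq_nonneg _
  constructor
  · rintro ⟨hs, hle⟩
    refine Matrix.PosSemidef.of_dotProduct_mulVec_nonneg ?_ ?_
    · rw [hM]
      ext i j
      rw [conjTranspose_apply, star_trivial]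
      by_cases hij : i = j
      · rw [hij]
      · have hji : ¬ j = i := fun h => hij h.symm
        by_cases hi : (i : ℕ) = 0 <;> by_cases hj : (j : ℕ) = 0
        · exact absurd (Fin.ext (hi.trans hj.symm)) hij
        all_goals
          simp only [Matrix.add_apply, Matrix.smul_apply, Matrix.of_apply, Matrix.one_apply,
            if_neg hij, if_neg hji, hi, hj, and_true, and_false, true_and, false_and, if_true,
            if_false]
    · intro v
      rw [hq v]
      have hcs := Finset.sum_mul_sq_le_sq_mul_sq Finset.univ
        (fun j : Fin (e + 1) => c j.succ) (fun j => v j.succ)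
      rw [← hC] at hcs
      set p := ∑ j : Fin (e + 1), c j.succ * v j.succ
      have hw0 : 0 ≤ ∑ j : Fin (e + 1), v j.succ ^ 2 := Finset.sum_nonneg fun _ _ => sq_nonneg _
      set w := ∑ j : Fin (e + 1), v j.succ ^ 2
      have habs := abs_le_of_sq_le_sq' (a := c 0) (b := s) (by linarith) hs
      have ha : 0 ≤ s + c 0 := by linarith [habs.1]
      have hb : 0 ≤ s - c 0 := by linarith [habs.2]
      have hp : p ^ 2 ≤ (s + c 0) * (s - c 0) * w := by
        refine hcs.trans (mul_le_mul_of_nonneg_right ?_ hw0)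
        linarith
      generalize s + c 0 = a at *
      generalize s - c 0 = b at *
      rcases ha.eq_or_lt with ha | ha
      · subst ha
        have : p = 0 := by nlinarith
        rw [this]; nlinarith [mul_nonneg hb hw0]
      · have : 0 ≤ a * (a * v 0 ^ 2 + 2 * v 0 * p + b * w) := by
          nlinarith [sq_nonneg (a * v 0 + p)]
        exact nonneg_of_mul_nonneg_right this ha
  · intro h
    have hn : ∀ x l : ℝ, 0 ≤ (s + c 0) * x ^ 2 + 2 * x * (l * C) + (s - c 0) * (l ^ 2 * C) := by
      intro x l
      have := h.dotProduct_mulVec_nonneg (Fin.cons x (fun j => l * c j.succ))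
      rw [hq] at this
      simp only [Fin.cons_zero, Fin.cons_succ] at this
      have u1 : ∑ j : Fin (e + 1), c j.succ * (l * c j.succ) = l * C := by
        rw [hC, Finset.mul_sum]; exact Finset.sum_congr rfl fun _ _ => by ring
      have u2 : ∑ j : Fin (e + 1), (l * c j.succ) ^ 2 = l ^ 2 * C := by
        rw [hC, Finset.mul_sum]; exact Finset.sum_congr rfl fun _ _ => by ring
      rwa [u1, u2] at this
    have ha : 0 ≤ s + c 0 := by simpa using hn 1 0
    have hb : 0 ≤ s - c 0 := by
      have := h.dotProduct_mulVec_nonneg (Fin.cons 0 (Pi.single 0 1))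
      rw [hq] at this
      simpa [Pi.single_apply, ite_pow] using this
    have key : C ≤ (s + c 0) * (s - c 0) := by
      rcases hb.eq_or_lt with hb | hb
      · rw [← hb] at hn ⊢
        by_contra hlt
        have hCp : 0 < C := by linarith
        have := hn (-1) ((s + c 0 + 1) / (2 * C))
        have e1 : (s + c 0 + 1) / (2 * C) * C = (s + c 0 + 1) / 2 := by field_simp
        rw [e1] at this
        linarith
      · have := hn (-(s - c 0)) 1
        have : 0 ≤ (s - c 0) * ((s + c 0) * (s - c 0) - C) := by nlinarith
        have := nonneg_of_mul_nonneg_right this hb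
        linarith
    exact ⟨by linarith, by nlinarith⟩

theorem stmt16 {n : ℕ} (hn : 2 ≤ n) (d : ℕ) (hd : d = n * (n + 1) / 2 - 1)
    (B : Fin d → Matrix (Fin n) (Fin n) ℝ)
    (hBsym : ∀ i, (B i).IsHermitian)
    (hBtr : ∀ i, (B i).trace = 0)
    (hBorth : ∀ i j, (B i * B j).trace = if i = j then 1 else 0)
    (hBli : LinearIndependent ℝ B)
    (hBspan : ∀ A : Matrix (Fin n) (Fin n) ℝ, A.IsHermitian → A.trace = 0 →
      A ∈ Submodule.span ℝ (Set.range B))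
    (X : Matrix (Fin n) (Fin n) ℝ) (hX : X.IsHermitian) :
    (∀ t : ℝ, Ek n 2 (X - t • 1) = 0 → 0 ≤ t) ↔
      ((Real.sqrt (((n : ℝ) - 1) / n) * X.trace) • (1 : Matrix (Fin d) (Fin d) ℝ) +
        Matrix.of (fun i j : Fin d =>
          if (i : ℕ) = 0 ∧ (j : ℕ) = 0 then (B i * X).trace
          else if (i : ℕ) = 0 then (B j * X).trace
          else if (j : ℕ) = 0 then (B i * X).trace
          else if i = j then
            -(B (⟨0, by (have h6 : 6 ≤ n * (n + 1) := by nlinarith); omega⟩ : Fin d) * X).trace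
          else 0)).PosSemidef := by
  have hd2 : 2 ≤ d := by
    have h6 : 6 ≤ n * (n + 1) := by nlinarith
    omega
  have hm : (2 : ℝ) ≤ n := by exact_mod_cast hn
  have hm0 : (n : ℝ) ≠ 0 := by linarith
  set T := X.trace with hT
  have hR : ∑ i, ((B i * X).trace) ^ 2 = (X * X).trace - T ^ 2 / n := by
    have hmem := hBspan (X - (T / n) • 1) (hX.sub (by simp [Matrix.IsHermitian])) (by
      simp [trace_sub, ← hT]; field_simp; simp)
    obtain ⟨a, ha⟩ := (Submodule.mem_span_range_iff_exists_fun ℝ).1 hmem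
    have hc : ∀ j, (B j * X).trace = a j := by
      intro j
      have h1 : (B j * (X - (T / n) • 1)).trace = (B j * X).trace := by
        simp [mul_sub, trace_sub, hBtr]
      rw [← h1, ← ha]
      simp [Finset.mul_sum, trace_sum, hBorth]
    have h2 : ((X - (T / n) • 1) * (X - (T / n) • 1)).trace = ∑ i, a i ^ 2 := by
      conv_lhs => enter [1, 1]; rw [← ha]
      rw [Finset.sum_mul, trace_sum]
      refine Finset.sum_congr rfl fun i _ => ?_
      have h1 : (B i * (X - (T / n) • 1)).trace = (B i * X).trace := by
        simp [mul_sub, trace_sub, hBtr]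
      rw [Matrix.smul_mul, trace_smul, h1, hc, smul_eq_mul, sq]
    simp only [hc]
    rw [← h2, aux_trace_shift, ← hT]
    field_simp
    ring
  rw [← aux_psd d hd2 _ (fun i => (B i * X).trace) _ rfl,
    ← aux_roots (n : ℝ) T (X * X).trace _ hm hR (Finset.sum_nonneg fun _ _ => sq_nonneg _)]
  simp only [aux_quad hn X hX, ← hT]
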